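/- arXiv:1102.1695 — 2 statements merged into one kernel-verified Lean document; each statement's English description precedes it below -/
import Mathlib

section
/- Let d ≥ 1 and let α > 0 with α ≠ 1. Let ξ, η ∈ ℝ^d with η ≠ 0 and ξ − η ≠ 0. Then: (a) ‖η‖^{α−2} η = ‖ξ−η‖^{α−2} (ξ−η) if and only if ξ = 2η (i.e. the space-resonant condition for the ++ phase forces ξ = 2η, so 𝒮 is contained in the linear subspace {ξ = 2η}); and (b) if ξ = 2η, then the ++ phase satisfies φ(ξ,η) = ‖ξ‖^α − ‖η‖^α − ‖ξ−η‖^α = (2^α − 2)‖η‖^α ≠ 0, so the ++ interaction has no space-time resonances with η ≠ 0 and ξ − η ≠ 0. -/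
/-- The map `x ↦ ‖x‖ ^ (α - 2) • x` is injective away from the origin when `α ≠ 1`. -/
theorem injOn_norm_rpow_smul {E : Type*} [NormedAddCommGroup E] [NormedSpace ℝ E] {α : ℝ}
    (hα : α ≠ 1) : Set.InjOn (fun x : E => ‖x‖ ^ (α - 2) • x) {0}ᶜ := by
  have norm_eq (z : E) (hz : z ≠ 0) : ‖‖z‖ ^ (α - 2) • z‖ = ‖z‖ ^ (α - 1) := by
    rw [norm_smul, Real.norm_of_nonneg (by positivity),
      ← Real.rpow_add_one (norm_ne_zero_iff.mpr hz)]
    ring_nf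
  intro x hx y hy h
  have hxy : ‖x‖ = ‖y‖ := by
    have hn := congrArg norm h
    rw [norm_eq x hx, norm_eq y hy] at hn
    exact (Real.rpow_left_inj (norm_nonneg x) (norm_nonneg y) (sub_ne_zero.mpr hα)).mp hn
  have hpos : 0 < ‖y‖ ^ (α - 2) := Real.rpow_pos_of_pos (norm_pos_iff.mpr hy) _
  simp only [hxy] at h
  exact smul_right_injective E hpos.ne' h

/-- Space resonances of the `++` interaction for `P(ξ) = ‖ξ‖^α`, `α > 0`, `α ≠ 1`,
at nondegenerate frequencies (`η ≠ 0`, `ξ - η ≠ 0`):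
(a) the space-resonant condition `‖η‖^{α-2}η = ‖ξ-η‖^{α-2}(ξ-η)` holds iff `ξ = 2η`;
(b) if `ξ = 2η` then the `++` phase `‖ξ‖^α - ‖η‖^α - ‖ξ-η‖^α` equals
`(2^α - 2)‖η‖^α ≠ 0`, so there are no nondegenerate space-time resonances. -/
theorem homogeneous_pp_no_spacetime_resonance (d : ℕ) (hd : 1 ≤ d) (α : ℝ)
    (hα₀ : 0 < α) (hα₁ : α ≠ 1) (ξ η : EuclideanSpace ℝ (Fin d))
    (hη : η ≠ 0) (hξη : ξ - η ≠ 0) :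
    ((‖η‖ ^ (α - 2)) • η = (‖ξ - η‖ ^ (α - 2)) • (ξ - η) ↔ ξ = (2 : ℝ) • η) ∧
    (ξ = (2 : ℝ) • η →
      ‖ξ‖ ^ α - ‖η‖ ^ α - ‖ξ - η‖ ^ α = ((2 : ℝ) ^ α - 2) * ‖η‖ ^ α ∧
      ‖ξ‖ ^ α - ‖η‖ ^ α - ‖ξ - η‖ ^ α ≠ 0) := by
  have heq : η = ξ - η ↔ ξ = (2 : ℝ) • η := by
    rw [two_smul, eq_sub_iff_add_eq, eq_comm]
  refine ⟨((injOn_norm_rpow_smul hα₁).eq_iff hη hξη).trans heq, fun h => ?_⟩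
  have phase : ‖ξ‖ ^ α - ‖η‖ ^ α - ‖ξ - η‖ ^ α = ((2 : ℝ) ^ α - 2) * ‖η‖ ^ α := by
    rw [← heq.mpr h, h, norm_smul, Real.norm_two, Real.mul_rpow zero_le_two (norm_nonneg η)]
    ring
  refine ⟨phase, phase ▸ mul_ne_zero (sub_ne_zero.mpr fun h2 => hα₁ ?_)
    (Real.rpow_pos_of_pos (norm_pos_iff.mpr hη) α).ne'⟩
  exact (Real.rpow_right_inj two_pos (by norm_num)).mp (h2.trans (Real.rpow_one 2).symm)
end

section
/- Let d ≥ 1 and let α > 0 with α ≠ 1. Let ξ, η ∈ ℝ^d with η ≠ 0 and ξ − η ≠ 0. Then: (a) ‖η‖^{α−2} η + ‖ξ−η‖^{α−2} (ξ−η) = 0 if and only if ξ = 0 (i.e. the space-resonant condition for the +− phase forces ξ = 0); and (b) for every η ≠ 0 one has both ‖0‖^α − ‖η‖^α + ‖0−η‖^α = 0 and ‖η‖^{α−2} η + ‖0−η‖^{α−2} (0−η) = 0, so every point (0,η) with η ≠ 0 is a space-time resonance of the +− interaction: ℛ ∩ {η ≠ 0, ξ−η ≠ 0} = {(ξ,η)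 : ξ = 0, η ≠ 0}. -/
/-- The norm of the gradient direction `‖x‖ ^ (α - 2) • x` is `‖x‖ ^ (α - 1)`. -/
theorem norm_rpow_sub_two_smul_self {E : Type*} [NormedAddCommGroup E] [NormedSpace ℝ E]
    (α : ℝ) {x : E} (hx : x ≠ 0) : ‖(‖x‖ ^ (α - 2)) • x‖ = ‖x‖ ^ (α - 1) := by
  have hpos : 0 < ‖x‖ := norm_pos_iff.mpr hx
  rw [norm_smul, Real.norm_of_nonneg (Real.rpow_nonneg hpos.le _),
    ← Real.rpow_add_one hpos.ne']
  congr 1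
  ring

/-- For `α ≠ 1`, the vectors `‖x‖ ^ (α - 2) • x` and `‖y‖ ^ (α - 2) • y` with `x, y ≠ 0` cancel
exactly when `x` and `y` do. -/
theorem norm_rpow_sub_two_smul_add_eq_zero_iff {E : Type*} [NormedAddCommGroup E]
    [NormedSpace ℝ E] {α : ℝ} (hα : α ≠ 1) {x y : E} (hx : x ≠ 0) (hy : y ≠ 0) :
    (‖x‖ ^ (α - 2)) • x + (‖y‖ ^ (α - 2)) • y = 0 ↔ x + y = 0 := by
  have hsmul {z : E} (h : ‖x‖ = ‖z‖) :
      (‖x‖ ^ (α - 2)) • x + (‖z‖ ^ (α - 2)) • z = (‖x‖ ^ (α - 2)) • (x + z) := by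
    rw [← h, smul_add]
  constructor
  · intro h
    have hpow : ‖x‖ ^ (α - 1) = ‖y‖ ^ (α - 1) := by
      rw [← norm_rpow_sub_two_smul_self α hx, ← norm_rpow_sub_two_smul_self α hy,
        eq_neg_of_add_eq_zero_left h, norm_neg]
    have hnorm : ‖x‖ = ‖y‖ :=
      (Real.rpow_left_inj (norm_nonneg x) (norm_nonneg y) (sub_ne_zero.mpr hα)).mp hpow
    rw [hsmul hnorm] at h
    exact (smul_eq_zero.mp h).resolve_left
      (Real.rpow_pos_of_pos (norm_pos_iff.mpr hx) _).ne'
  · intro h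
    rw [hsmul (by rw [eq_neg_of_add_eq_zero_left h, norm_neg]), h, smul_zero]

/-- Space-time resonances of the `+-` interaction for `P(ξ) = ‖ξ‖^α`, `α > 0`,
`α ≠ 1`, at nondegenerate frequencies (`η ≠ 0`, `ξ - η ≠ 0`):
(a) the space-resonant condition `‖η‖^{α-2}η + ‖ξ-η‖^{α-2}(ξ-η) = 0` holds iff
`ξ = 0`; (b) every point `(0,η)` with `η ≠ 0` is a space-time resonance, and the
nondegenerate part of the space-time resonant set is exactly `{(ξ,η) : ξ = 0, η ≠ 0}`. -/
theorem homogeneous_pm_spacetime_resonance (d : ℕ) (hd : 1 ≤ d) (α : ℝ)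
    (hα₀ : 0 < α) (hα₁ : α ≠ 1) (ξ η : EuclideanSpace ℝ (Fin d))
    (hη : η ≠ 0) (hξη : ξ - η ≠ 0) :
    ((‖η‖ ^ (α - 2)) • η + (‖ξ - η‖ ^ (α - 2)) • (ξ - η) = 0 ↔ ξ = 0) ∧
    (∀ η' : EuclideanSpace ℝ (Fin d), η' ≠ 0 →
      ‖(0 : EuclideanSpace ℝ (Fin d))‖ ^ α - ‖η'‖ ^ α +
          ‖(0 : EuclideanSpace ℝ (Fin d)) - η'‖ ^ α = 0 ∧
      (‖η'‖ ^ (α - 2)) • η' +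
          (‖(0 : EuclideanSpace ℝ (Fin d)) - η'‖ ^ (α - 2)) •
            ((0 : EuclideanSpace ℝ (Fin d)) - η') = 0) ∧
    {p : EuclideanSpace ℝ (Fin d) × EuclideanSpace ℝ (Fin d) |
        p.2 ≠ 0 ∧ p.1 - p.2 ≠ 0 ∧
        ‖p.1‖ ^ α - ‖p.2‖ ^ α + ‖p.1 - p.2‖ ^ α = 0 ∧
        (‖p.2‖ ^ (α - 2)) • p.2 + (‖p.1 - p.2‖ ^ (α - 2)) • (p.1 - p.2) = 0} =
      {p | p.1 = 0 ∧ p.2 ≠ 0} := by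
  have space {ξ η : EuclideanSpace ℝ (Fin d)} (hη : η ≠ 0) (hξη : ξ - η ≠ 0) :
      (‖η‖ ^ (α - 2)) • η + (‖ξ - η‖ ^ (α - 2)) • (ξ - η) = 0 ↔ ξ = 0 := by
    rw [norm_rpow_sub_two_smul_add_eq_zero_iff hα₁ hη hξη, add_sub_cancel]
  have resonant (η : EuclideanSpace ℝ (Fin d)) (hη : η ≠ 0) :
      ‖(0 : EuclideanSpace ℝ (Fin d))‖ ^ α - ‖η‖ ^ α +
          ‖(0 : EuclideanSpace ℝ (Fin d)) - η‖ ^ α = 0 ∧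
      (‖η‖ ^ (α - 2)) • η +
          (‖(0 : EuclideanSpace ℝ (Fin d)) - η‖ ^ (α - 2)) •
            ((0 : EuclideanSpace ℝ (Fin d)) - η) = 0 := by
    refine ⟨?_, (space hη (by simpa using hη)).mpr rfl⟩
    simp [Real.zero_rpow hα₀.ne']
  refine ⟨space hη hξη, resonant, ?_⟩
  ext ⟨x, y⟩
  constructor
  · rintro ⟨hy, hxy, -, h⟩
    exact ⟨(space hy hxy).mp h, hy⟩
  · rintro ⟨rfl, hy⟩
    exact ⟨hy, by simpa using hy, resonant y hy⟩
end
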